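/- View ℍ² as a left module over the quaternions ℍ, with componentwise scalar multiplication. For every p ∈ ℍ² and every nonzero z ∈ ℍ whose j- and k-components vanish (i.e. z lies in the copy of ℂ spanned by 1 and i), the real spans coincide: span_ℝ{ j·(z·p), k·(z·p) } = span_ℝ{ j·p, k·p }. In particular, the distribution 𝒟̃²(p) = span_ℝ{ j·p, k·p } on the unit sphere S⁷ ⊂ ℍ² is invariant under the complex scalar action defining the Hopf fibration S⁷ → ℂP³, so it descends to a well-defined rank-2 distribution 𝒟² on ℂP³. -/

import Mathlib

open Quaternion

/-- The quaternion `j`. -/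
def qj : Quaternion ℝ := ⟨0, 0, 1, 0⟩

/-- The quaternion `k`. -/
def qk : Quaternion ℝ := ⟨0, 0, 0, 1⟩

@[simp] theorem re_qj : qj.re = 0 := rfl
@[simp] theorem imI_qj : qj.imI = 0 := rfl
@[simp] theorem imJ_qj : qj.imJ = 1 := rfl
@[simp] theorem imK_qj : qj.imK = 0 := rfl

@[simp] theorem re_qk : qk.re = 0 := rfl
@[simp] theorem imI_qk : qk.imI = 0 := rfl
@[simp] theorem imJ_qk : qk.imJ = 0 := rfl
@[simp] theorem imK_qk : qk.imK = 1 := rfl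

theorem qj_mul_of_imJ_imK_eq_zero {z : Quaternion ℝ} (hzj : z.imJ = 0) (hzk : z.imK = 0) :
    qj * z = z.re • qj - z.imI • qk := by
  apply Quaternion.ext <;> simp [hzj, hzk]

theorem qk_mul_of_imJ_imK_eq_zero {z : Quaternion ℝ} (hzj : z.imJ = 0) (hzk : z.imK = 0) :
    qk * z = z.imI • qj + z.re • qk := by
  apply Quaternion.ext <;> simp [hzj, hzk]

/-- Multiplying by a complex scalar first can only shrink the span of `j • p` and `k • p`. -/
theorem span_jk_smul_le (p : Quaternion ℝ × Quaternion ℝ) {z : Quaternion ℝ}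
    (hzj : z.imJ = 0) (hzk : z.imK = 0) :
    Submodule.span ℝ ({qj • (z • p), qk • (z • p)} : Set (Quaternion ℝ × Quaternion ℝ)) ≤
      Submodule.span ℝ ({qj • p, qk • p} : Set (Quaternion ℝ × Quaternion ℝ)) := by
  rw [Submodule.span_le, Set.pair_subset_iff]
  simp only [SetLike.mem_coe, Submodule.mem_span_pair]
  constructor
  · refine ⟨z.re, -z.imI, ?_⟩
    rw [smul_smul qj, qj_mul_of_imJ_imK_eq_zero hzj hzk, sub_smul, smul_assoc, smul_assoc,
      neg_smul, sub_eq_add_neg]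
  · refine ⟨z.imI, z.re, ?_⟩
    rw [smul_smul qk, qk_mul_of_imJ_imK_eq_zero hzj hzk, add_smul, smul_assoc, smul_assoc]

/-- View `ℍ²` as a left `ℍ`-module with componentwise scalar
multiplication. For every `p ∈ ℍ²` and every nonzero `z ∈ ℍ` with vanishing `j`- and
`k`-components (that is, `z` in the copy of `ℂ` spanned by `1` and `i`), the real spans
coincide: `span_ℝ {j•(z•p), k•(z•p)} = span_ℝ {j•p, k•p}`. Hence the distribution
`𝒟̃²(p) = span_ℝ {j•p, k•p}` on `S⁷ ⊂ ℍ²` is invariant under the complex scalar action of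
the Hopf fibration `S⁷ → ℂP³` and descends to a rank-2 distribution `𝒟²` on `ℂP³`. -/
theorem span_jk_invariant (p : Quaternion ℝ × Quaternion ℝ) (z : Quaternion ℝ)
    (hz : z ≠ 0) (hzj : z.imJ = 0) (hzk : z.imK = 0) :
    Submodule.span ℝ ({qj • (z • p), qk • (z • p)} : Set (Quaternion ℝ × Quaternion ℝ)) =
      Submodule.span ℝ ({qj • p, qk • p} : Set (Quaternion ℝ × Quaternion ℝ)) := by
  refine le_antisymm (span_jk_smul_le p hzj hzk) ?_
  have hj : (z⁻¹).imJ = 0 := by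
    rw [Quaternion.inv_def, Quaternion.imJ_smul, Quaternion.imJ_star, hzj, neg_zero, smul_zero]
  have hk : (z⁻¹).imK = 0 := by
    rw [Quaternion.inv_def, Quaternion.imK_smul, Quaternion.imK_star, hzk, neg_zero, smul_zero]
  simpa only [inv_smul_smul₀ hz] using span_jk_smul_le (z • p) hj hk
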